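/- arXiv:2305.15125 — 2 statements merged into one kernel-verified Lean document; each statement's English description precedes it below -/
import Mathlib

section
/- Let S_1, …, S_m be M♮-convex subsets of ℤ^n with n ≥ 2, and W = S_1 + ⋯ + S_m. For any x in the convex hull of W, there exists z ∈ W with ‖x − z‖_∞ ≤ 1 − 1/n. -/
open scoped BigOperators Pointwise

noncomputable section

/-- Coercion of an integer vector to a real vector (sup-norm space). -/
def coeZR {n : ℕ} (v : Fin n → ℤ) : Fin n → ℝ := fun i => (v i : ℝ)

/-- Minkowski sum of a finite family of subsets of ℝ^n. -/
def minkSum {n m : ℕ} (S : Fin m → Set (Fin n → ℝ)) : Set (Fin n → ℝ) :=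
  {x | ∃ z : Fin m → (Fin n → ℝ), (∀ i, z i ∈ S i) ∧ x = ∑ i, z i}

/-- Minkowski sum of a finite family of subsets of ℤ^n. -/
def minkSumZ {n m : ℕ} (S : Fin m → Set (Fin n → ℤ)) : Set (Fin n → ℤ) :=
  {x | ∃ z : Fin m → (Fin n → ℤ), (∀ i, z i ∈ S i) ∧ x = ∑ i, z i}

/-- Integral neighborhood N(x) of a real vector x. -/
def intNbhd {n : ℕ} (x : Fin n → ℝ) : Set (Fin n → ℤ) :=
  {z | ∀ i, |x i - (z i : ℝ)| < 1}

/-- Integral convexity of a set S ⊆ ℤ^n. -/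
def IntegrallyConvex {n : ℕ} (S : Set (Fin n → ℤ)) : Prop :=
  S.Nonempty ∧ ∀ x ∈ convexHull ℝ (coeZR '' S),
    x ∈ convexHull ℝ (coeZR '' (S ∩ intNbhd x))

/-- M♮-convexity via the exchange property. -/
def MnatConvex {n : ℕ} (S : Set (Fin n → ℤ)) : Prop :=
  S.Nonempty ∧ ∀ x ∈ S, ∀ y ∈ S, ∀ i : Fin n, x i > y i →
    (x - Pi.single i 1 ∈ S ∧ y + Pi.single i 1 ∈ S) ∨
    ∃ j : Fin n, x j < y j ∧ x - Pi.single i 1 + Pi.single j 1 ∈ S ∧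
      y + Pi.single i 1 - Pi.single j 1 ∈ S

open Filter Topology

lemma circ_count {E A : Type*} [Fintype E] [DecidableEq A] (a : E → A) (PA : Set A)
    [DecidablePred (fun e => a e ∈ PA)]
    (ha : ∀ e, a e ∈ PA → ∃ e', e' ≠ e ∧ a e' = a e) :
    ((Finset.univ.filter (fun e => a e ∈ PA)).image a).card * 2
        ≤ (Finset.univ.filter (fun e => a e ∈ PA)).card := by
  classical
  rw [Finset.card_eq_sum_card_image a (Finset.univ.filter (fun e => a e ∈ PA))]
  rw [← smul_eq_mul]
  apply Finset.card_nsmul_le_sum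
  intro α hα
  obtain ⟨e, he, rfl⟩ := Finset.mem_image.1 hα
  have he' : a e ∈ PA := by simpa using he
  obtain ⟨e', hne, h⟩ := ha e he'
  apply Finset.one_lt_card.2
  refine ⟨e', ?_, e, ?_, hne⟩ <;> simp [h, he']

lemma circ {E A B : Type*} [Fintype E] [Nonempty E] (a : E → A) (b : E → B)
    (PA : Set A) (PB : Set B)
    (ha : ∀ e, a e ∈ PA → ∃ e', e' ≠ e ∧ a e' = a e)
    (hb : ∀ e, b e ∈ PB → ∃ e', e' ≠ e ∧ b e' = b e) :
    ∃ d : E → ℝ, d ≠ 0 ∧ (∀ α ∈ PA, ∑ e, (open Classical in if a e = α then d e else 0) = 0) ∧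
      (∀ β ∈ PB, ∑ e, (open Classical in if b e = β then d e else 0) = 0) := by
  classical
  have cA := circ_count a PA ha
  have cB := circ_count b PB hb
  set A' := (Finset.univ.filter (fun e => a e ∈ PA)).image a with hA'
  set B' := (Finset.univ.filter (fun e => b e ∈ PB)).image b with hB'
  have leA : (Finset.univ.filter (fun e => a e ∈ PA)).card ≤ Fintype.card E := Finset.card_le_univ _
  have leB : (Finset.univ.filter (fun e => b e ∈ PB)).card ≤ Fintype.card E := Finset.card_le_univ _
  let L : (E → ℝ) →ₗ[ℝ] ((A' → ℝ) × (B' → ℝ)) :=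
    { toFun := fun d => (fun α => ∑ e, if a e = α then d e else 0,
                         fun β => ∑ e, if b e = β then d e else 0)
      map_add' := by
        intro d d'
        ext α <;> simp only [Prod.fst_add, Prod.snd_add, Pi.add_apply, ← Finset.sum_add_distrib] <;>
          apply Finset.sum_congr rfl <;> intro e _ <;> split_ifs <;> simp
      map_smul' := by
        intro c d
        ext α <;> simp [Finset.mul_sum] }
  by_contra hcon
  push Not at hcon
  have hinj : Function.Injective L := by
    rw [← LinearMap.ker_eq_bot, LinearMap.ker_eq_bot']
    intro d hd
    by_contra hd0
    obtain ⟨β, hβ, h⟩ := hcon d hd0 (by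
      intro α hα
      by_cases h : α ∈ A'
      · have := congrFun (congrArg Prod.fst hd) ⟨α, h⟩
        simpa [L] using this
      · apply Finset.sum_eq_zero
        intro e _
        rw [if_neg]
        rintro rfl
        exact h (Finset.mem_image.2 ⟨e, by simpa using hα, rfl⟩))
    apply h
    by_cases h : β ∈ B'
    · have := congrFun (congrArg Prod.snd hd) ⟨β, h⟩
      simpa [L] using this
    · apply Finset.sum_eq_zero
      intro e _
      rw [if_neg]
      rintro rfl
      exact h (Finset.mem_image.2 ⟨e, by simpa using hβ, rfl⟩)
  have hle := LinearMap.finrank_le_finrank_of_injective hinj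
  have hfr : Module.finrank ℝ ((A' → ℝ) × (B' → ℝ)) = A'.card + B'.card := by
    simp [Module.finrank_prod]
  have hfrE : Module.finrank ℝ (E → ℝ) = Fintype.card E := by simp
  rw [hfr, hfrE] at hle
  have heq : Module.finrank ℝ (E → ℝ) = Module.finrank ℝ ((A' → ℝ) × (B' → ℝ)) := by
    rw [hfr, hfrE]; omega
  have hsurj := (LinearMap.injective_iff_surjective_of_finrank_eq_finrank heq).1 hinj
  have fA : Finset.univ.filter (fun e => a e ∈ PA) = Finset.univ :=
    Finset.card_eq_iff_eq_univ _ |>.1 (by omega)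
  have fB : Finset.univ.filter (fun e => b e ∈ PB) = Finset.univ :=
    Finset.card_eq_iff_eq_univ _ |>.1 (by omega)
  have mA : ∀ e, a e ∈ A' := fun e => by rw [hA', fA]; simp
  have mB : ∀ e, b e ∈ B' := fun e => by rw [hB', fB]; simp
  obtain ⟨d, hd⟩ := hsurj (fun _ => 1, fun _ => 0)
  have s1 : ∑ e, d e = ∑ α : A', ∑ e, if a e = α then d e else 0 := by
    rw [Finset.sum_comm]
    apply Finset.sum_congr rfl
    intro e _
    rw [Finset.sum_eq_single ⟨a e, mA e⟩]
    · simp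
    · intro x _ hx
      rw [if_neg]
      intro h
      exact hx (Subtype.ext h.symm)
    · simp
  have s2 : ∑ e, d e = ∑ β : B', ∑ e, if b e = β then d e else 0 := by
    rw [Finset.sum_comm]
    apply Finset.sum_congr rfl
    intro e _
    rw [Finset.sum_eq_single ⟨b e, mB e⟩]
    · simp
    · intro x _ hx
      rw [if_neg]
      intro h
      exact hx (Subtype.ext h.symm)
    · simp
  have t1 : ∀ α : A', ∑ e, (if a e = α then d e else 0) = 1 := fun α =>
    congrFun (congrArg Prod.fst hd) α
  have t2 : ∀ β : B', ∑ e, (if b e = β then d e else 0) = 0 := fun β =>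
    congrFun (congrArg Prod.snd hd) β
  simp only [t1] at s1
  simp only [t2] at s2
  rw [s2] at s1
  simp at s1
  have := mA (Classical.arbitrary E)
  have h0 : A'.card = 0 := by exact_mod_cast s1.symm
  rw [Finset.card_eq_zero.1 h0] at this
  simp at this

lemma rep {E : Type*} [AddCommGroup E] [Module ℝ E] {T : Set E} {p : E}
    (hp : p ∈ convexHull ℝ T) : ∃ (U : Finset E) (w : E → ℝ), (∀ u ∈ U, u ∈ T) ∧
      (∀ u ∈ U, 0 < w u) ∧ ∑ u ∈ U, w u = 1 ∧ ∑ u ∈ U, w u • u = p := by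
  classical
  rw [convexHull_eq_union_convexHull_finite_subsets] at hp
  simp only [Set.mem_iUnion] at hp
  obtain ⟨V, hV, hp⟩ := hp
  rw [Finset.mem_convexHull'] at hp
  obtain ⟨w, h0, h1, h2⟩ := hp
  refine ⟨V.filter (fun u => w u ≠ 0), w, ?_, ?_, ?_, ?_⟩
  · intro u hu
    exact hV (Finset.mem_filter.1 hu).1
  · intro u hu
    have := Finset.mem_filter.1 hu
    exact lt_of_le_of_ne (h0 u this.1) (Ne.symm this.2)
  · rw [Finset.sum_filter_ne_zero, h1]
  · rw [← h2]
    apply Finset.sum_filter_of_ne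
    intro u _ h hw
    exact h (by simp [hw])

lemma move {E : Type*} [AddCommGroup E] [Module ℝ E] {T : Set E} {U : Finset E} {w : E → ℝ}
    (hU : ∀ u ∈ U, u ∈ T) (hw : ∀ u ∈ U, 0 < w u) (h1 : ∑ u ∈ U, w u = 1)
    {s v : E} (hs : s ∈ U) (hv : v ∈ T) :
    (∑ u ∈ U, w u • u) + w s • (v - s) ∈ convexHull ℝ T := by
  classical
  have : (∑ u ∈ U, w u • u) + w s • (v - s) = ∑ u ∈ U, w u • (if u = s then v else u) := by
    rw [← Finset.add_sum_erase _ _ hs, ← Finset.add_sum_erase _ _ hs, if_pos rfl]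
    rw [Finset.sum_congr rfl (g := fun u => w u • u) (s₁ := U.erase s)
      (f := fun u => w u • (if u = s then v else u))]
    · module
    · intro u hu
      rw [if_neg (Finset.ne_of_mem_erase hu)]
  rw [this]
  apply (convex_convexHull ℝ T).sum_mem (fun u hu => (hw u hu).le) h1
  intro u hu
  apply subset_convexHull
  split_ifs
  · exact hv
  · exact hU u hu

/-- shrink a step inside a convex set -/
lemma shrink {E : Type*} [AddCommGroup E] [Module ℝ E] {C : Set E} (hC : Convex ℝ C) {x d : E}
    (hx : x ∈ C) {r t : ℝ} (h : x + r • d ∈ C) (ht : 0 ≤ t) (htr : t ≤ r) : x + t • d ∈ C := by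
  rcases eq_or_lt_of_le (ht.trans htr) with h0 | h0
  · have : t = 0 := by linarith
    simpa [this] using hx
  · have := hC.add_smul_mem hx h (t := t / r) ⟨by positivity, by rw [div_le_one h0]; exact htr⟩
    rwa [smul_smul, div_mul_cancel₀ _ h0.ne'] at this

def dirs {E : Type*} [AddCommGroup E] [Module ℝ E] (C : Set E) (hC : Convex ℝ C) (x : E)
    (hx : x ∈ C) : Submodule ℝ E where
  carrier := {d | ∀ᶠ t in 𝓝 (0:ℝ), x + t • d ∈ C}
  zero_mem' := by simp [hx]
  add_mem' := by
    intro d1 d2 h1 h2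
    have ht : Tendsto (fun t : ℝ => 2 * t) (𝓝 0) (𝓝 0) := by
      have : Continuous (fun t : ℝ => 2 * t) := by fun_prop
      simpa using this.tendsto 0
    filter_upwards [ht.eventually h1, ht.eventually h2] with t k1 k2
    have := hC k1 k2 (a := 1/2) (b := 1/2) (by norm_num) (by norm_num) (by norm_num)
    convert this using 1
    module
  smul_mem' := by
    intro c d h
    have ht : Tendsto (fun t : ℝ => t * c) (𝓝 0) (𝓝 0) := by
      have : Continuous (fun t : ℝ => t * c) := by fun_prop
      simpa using this.tendsto 0
    filter_upwards [ht.eventually h] with t k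
    rwa [smul_smul]

lemma mem_dirs_of {E : Type*} [AddCommGroup E] [Module ℝ E] {C : Set E} (hC : Convex ℝ C) {x : E}
    (hx : x ∈ C) {d : E} {r1 r2 : ℝ} (h1 : 0 < r1) (h2 : 0 < r2) (m1 : x + r1 • d ∈ C)
    (m2 : x + r2 • (-d) ∈ C) : d ∈ dirs C hC x hx := by
  change ∀ᶠ t in 𝓝 (0:ℝ), x + t • d ∈ C
  filter_upwards [Ioo_mem_nhds (show -r2 < 0 by linarith) h1] with t ht
  rcases le_total 0 t with h | h
  · exact shrink hC hx m1 h ht.2.le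
  · have := shrink hC hx m2 (t := -t) (by linarith) (by linarith [ht.1])
    simpa using this

/-- exchange property -/
def Exch {n : ℕ} (S : Set (Fin n → ℤ)) : Prop :=
  ∀ x ∈ S, ∀ y ∈ S, ∀ i : Fin n, x i > y i →
    (x - Pi.single i 1 ∈ S ∧ y + Pi.single i 1 ∈ S) ∨
    ∃ j : Fin n, x j < y j ∧ x - Pi.single i 1 + Pi.single j 1 ∈ S ∧
      y + Pi.single i 1 - Pi.single j 1 ∈ S

lemma Exch.box {n : ℕ} {S : Set (Fin n → ℤ)} (h : Exch S) (a b : Fin n → ℤ) :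
    Exch (S ∩ Set.Icc a b) := by
  rintro x ⟨hx, hxa, hxb⟩ y ⟨hy, hya, hyb⟩ i hi
  rcases h x hx y hy i hi with ⟨h1, h2⟩ | ⟨j, hj, h1, h2⟩
  · left
    refine ⟨⟨h1, ?_, ?_⟩, ⟨h2, ?_, ?_⟩⟩ <;> intro l <;>
      have q1 : a l ≤ x l := hxa l <;> have q2 : x l ≤ b l := hxb l <;>
      have q3 : a l ≤ y l := hya l <;> have q4 : y l ≤ b l := hyb l <;>
      simp only [Pi.single_apply, Pi.add_apply, Pi.sub_apply] <;> split_ifs <;> subst_vars <;> omega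
  · right
    have hij : i ≠ j := by rintro rfl; omega
    refine ⟨j, hj, ⟨h1, ?_, ?_⟩, ⟨h2, ?_, ?_⟩⟩ <;> intro l <;>
      have q1 : a l ≤ x l := hxa l <;> have q2 : x l ≤ b l := hxb l <;>
      have q3 : a l ≤ y l := hya l <;> have q4 : y l ≤ b l := hyb l <;>
      simp only [Pi.single_apply, Pi.add_apply, Pi.sub_apply] <;> split_ifs <;> subst_vars <;> omega

/-- lifting to the paraboloid -/
def lft {n : ℕ} (v : Fin n → ℤ) : (Fin n → ℝ) × ℝ := (coeZR v, ∑ i, (v i : ℝ) ^ 2)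

lemma exch_sq {n : ℕ} {T : Set (Fin n → ℤ)} (h : Exch T) {s t : Fin n → ℤ} (hs : s ∈ T) (ht : t ∈ T)
    {i : Fin n} (hi : t i + 2 ≤ s i) : ∃ s' ∈ T, ∃ t' ∈ T, coeZR s' - coeZR s + (coeZR t' - coeZR t) = 0 ∧
      (lft s').2 - (lft s).2 + ((lft t').2 - (lft t).2) < 0 := by
  rcases h s hs t ht i (by omega) with ⟨h1, h2⟩ | ⟨j, hj, h1, h2⟩
  · refine ⟨_, h1, _, h2, ?_, ?_⟩
    · ext l; simp [coeZR]
    · simp only [lft, ← Finset.sum_sub_distrib, ← Finset.sum_add_distrib]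
      norm_cast
      apply lt_of_le_of_lt (b := ∑ l, if l = i then -2 else (0:ℤ))
      · apply Finset.sum_le_sum
        intro l _
        by_cases hl : l = i
        · subst hl
          simp
          nlinarith
        · simp [Pi.single_apply, hl]
      · simp
  · have hij : i ≠ j := by rintro rfl; omega
    refine ⟨_, h1, _, h2, ?_, ?_⟩
    · ext l; simp [coeZR]; ring
    · simp only [lft, ← Finset.sum_sub_distrib, ← Finset.sum_add_distrib]
      norm_cast
      apply lt_of_le_of_lt (b := ∑ l, if l = i then -2 else (0:ℤ))
      · apply Finset.sum_le_sum
        intro l _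
        by_cases hl : l = i
        · subst hl
          simp [Pi.single_apply, hij]
          nlinarith
        · by_cases hl' : l = j
          · subst hl'
            simp [Pi.single_apply, hl]
            nlinarith
          · simp [Pi.single_apply, hl, hl']
      · simp

/-- integral convexity (unit cube form) -/
lemma unit_cube {n : ℕ} {S : Set (Fin n → ℤ)} (h : Exch S) {x : Fin n → ℝ}
    (hx : x ∈ convexHull ℝ (coeZR '' S)) :
    ∃ lo : Fin n → ℤ, x ∈ convexHull ℝ (coeZR '' (S ∩ Set.Icc lo (lo + 1))) := by
  classical
  -- restrict to a box
  have hbox : ∃ a b : Fin n → ℤ, x ∈ convexHull ℝ (coeZR '' (S ∩ Set.Icc a b)) := by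
    obtain ⟨U, w, hU, hw, h1, h2⟩ := rep hx
    choose! f hf using hU
    obtain ⟨a, ha⟩ := (U.image f).bddBelow
    obtain ⟨b, hb⟩ := (U.image f).bddAbove
    refine ⟨a, b, ?_⟩
    rw [← h2]
    apply (convex_convexHull ℝ _).sum_mem (fun u hu => (hw u hu).le) h1
    intro u hu
    apply subset_convexHull
    have hm : f u ∈ (U.image f) := Finset.mem_image_of_mem _ hu
    exact ⟨f u, ⟨(hf u hu).1, ha hm, hb hm⟩, (hf u hu).2⟩
  obtain ⟨a, b, hx⟩ := hbox
  set T := S ∩ Set.Icc a b with hT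
  have hTe : Exch T := h.box a b
  have hTf : T.Finite := (Set.finite_Icc a b).subset Set.inter_subset_right
  set H := convexHull ℝ (lft '' T) with hH
  have hHc : IsCompact H := (hTf.image lft).isCompact_convexHull ℝ
  let K := H ∩ {p | p.1 = x}
  have hK : IsCompact K := hHc.inter_right (isClosed_eq continuous_fst continuous_const)
  have hKn : K.Nonempty := by
    have : coeZR '' T = (LinearMap.fst ℝ (Fin n → ℝ) ℝ) '' (lft '' T) := by
      rw [Set.image_image]; rfl
    rw [this, ← LinearMap.image_convexHull] at hx
    obtain ⟨p, hp, hpx⟩ := hx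
    exact ⟨p, hp, hpx⟩
  obtain ⟨p, ⟨hpH, hpx⟩, hmin⟩ := hK.exists_isMinOn hKn continuous_snd.continuousOn
  obtain ⟨U, w, hU, hw, h1, h2⟩ := rep hpH
  choose! f hf using hU
  have key : ∀ u ∈ U, ∀ v ∈ U, ∀ i, f u i ≤ f v i + 1 := by
    intro u hu v hv i
    by_contra hcon
    obtain ⟨s', hs', t', ht', e1, e2⟩ := exch_sq hTe (hf u hu).1 (hf v hv).1 (i := i) (by omega)
    have m1 := move (fun u hu => (⟨f u, hf u hu⟩ : u ∈ lft '' T)) hw h1 hu (Set.mem_image_of_mem lft hs')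
    have m2 := move (fun u hu => (⟨f u, hf u hu⟩ : u ∈ lft '' T)) hw h1 hv (Set.mem_image_of_mem lft ht')
    rw [h2] at m1 m2
    have hC := convex_convexHull ℝ (lft '' T)
    set r := min (w u) (w v) with hr
    have hr0 : 0 < r := lt_min (hw u hu) (hw v hv)
    have k1 := shrink hC hpH m1 hr0.le (min_le_left _ _)
    have k2 := shrink hC hpH m2 hr0.le (min_le_right _ _)
    have k := hC k1 k2 (a := 1/2) (b := 1/2) (by norm_num) (by norm_num) (by norm_num)
    have hq : (1/2:ℝ) • (p + r • (lft s' - u)) + (1/2:ℝ) • (p + r • (lft t' - v))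
        = p + (r/2) • ((lft s' - lft (f u)) + (lft t' - lft (f v))) := by
      rw [(hf u hu).2, (hf v hv).2]; module
    rw [hq] at k
    have hle := hmin (a := p + (r/2) • ((lft s' - lft (f u)) + (lft t' - lft (f v)))) ⟨k, by
      simp only [Set.mem_ofPred_eq, Prod.fst_add, Prod.smul_fst, Prod.fst_sub]
      rw [show (lft s').1 = coeZR s' from rfl, show (lft t').1 = coeZR t' from rfl,
        show (lft (f u)).1 = coeZR (f u) from rfl, show (lft (f v)).1 = coeZR (f v) from rfl, e1]
      simpa using hpx⟩
    simp only [Set.mem_ofPred_eq, Prod.snd_add, Prod.smul_snd, Prod.snd_sub, smul_eq_mul] at hle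
    nlinarith
  have hUn : U.Nonempty := by
    by_contra hc
    rw [Finset.not_nonempty_iff_eq_empty] at hc
    simp [hc] at h1
  refine ⟨fun i => U.inf' hUn (fun u => f u i), ?_⟩
  rw [← show p.1 = x from hpx, ← h2, Prod.fst_sum]
  apply (convex_convexHull ℝ _).sum_mem (fun u hu => (hw u hu).le) h1
  intro u hu
  apply subset_convexHull
  refine ⟨f u, ⟨(hf u hu).1.1, ?_, ?_⟩, ?_⟩
  · intro i
    exact Finset.inf'_le _ hu
  · intro i
    obtain ⟨v, hv, e⟩ := Finset.exists_mem_eq_inf' hUn (fun u => f u i)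
    change f u i ≤ U.inf' hUn (fun u => f u i) + 1
    rw [e]
    exact key u hu v hv i
  · conv_rhs => rw [← (hf u hu).2]
    rfl

lemma vtx {n : ℕ} {T : Set (Fin n → ℤ)} {lo : Fin n → ℤ} (hT : T ⊆ Set.Icc lo (lo + 1))
    {x : Fin n → ℝ} (hx : x ∈ convexHull ℝ (coeZR '' T)) (hint : ∀ i, ∃ z : ℤ, x i = z) :
    ∃ z ∈ T, coeZR z = x := by
  obtain ⟨U, w, hU, hw, h1, h2⟩ := rep hx
  choose! f hf using hU
  have hUn : U.Nonempty := by
    by_contra hc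
    rw [Finset.not_nonempty_iff_eq_empty] at hc
    simp [hc] at h1
  obtain ⟨u, hu⟩ := hUn
  refine ⟨f u, (hf u hu).1, ?_⟩
  have hcoord : ∀ i, ∑ v ∈ U, w v * (f v i : ℝ) = x i := by
    intro i
    rw [← h2, Finset.sum_apply]
    apply Finset.sum_congr rfl
    intro v hv
    rw [Pi.smul_apply, smul_eq_mul]
    rw [show v i = (f v i : ℝ) from (congrFun (hf v hv).2 i).symm]
  ext i
  obtain ⟨z, hz⟩ := hint i
  have hb : ∀ v ∈ U, lo i ≤ f v i ∧ f v i ≤ lo i + 1 := fun v hv =>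
    ⟨(hT (hf v hv).1).1 i, (hT (hf v hv).1).2 i⟩
  have hsum0 : ∑ v ∈ U, w v * ((f v i : ℝ) - lo i) = z - lo i := by
    simp only [mul_sub, Finset.sum_sub_distrib, ← Finset.sum_mul, h1, hcoord, hz]; ring
  have hsum1 : ∑ v ∈ U, w v * ((lo i + 1 : ℝ) - f v i) = lo i + 1 - z := by
    simp only [mul_sub, Finset.sum_sub_distrib, ← Finset.sum_mul, h1, hcoord, hz]; ring
  have nn0 : ∀ v ∈ U, 0 ≤ w v * ((f v i : ℝ) - lo i) := fun v hv => by
    have : (lo i : ℝ) ≤ f v i := by exact_mod_cast (hb v hv).1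
    exact mul_nonneg (hw v hv).le (by linarith)
  have nn1 : ∀ v ∈ U, 0 ≤ w v * ((lo i + 1 : ℝ) - f v i) := fun v hv => by
    have : (f v i : ℝ) ≤ lo i + 1 := by exact_mod_cast (hb v hv).2
    exact mul_nonneg (hw v hv).le (by linarith)
  have g0 := Finset.sum_nonneg nn0
  have g1 := Finset.sum_nonneg nn1
  rw [hsum0] at g0
  rw [hsum1] at g1
  have g0' : lo i ≤ z := by exact_mod_cast (by linarith : (lo i : ℝ) ≤ z)
  have g1' : z ≤ lo i + 1 := by exact_mod_cast (by linarith : (z : ℝ) ≤ lo i + 1)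
  have hwu := hw u hu
  change (f u i : ℝ) = x i
  rw [hz]
  rcases (by omega : z = lo i ∨ z = lo i + 1) with e | e
  · rw [e, sub_self] at hsum0
    have := (Finset.sum_eq_zero_iff_of_nonneg nn0).1 hsum0 u hu
    rcases mul_eq_zero.1 this with q | q
    · linarith
    · rw [e]; linarith
  · have e' : (z : ℝ) = lo i + 1 := by rw [e]; push_cast; ring
    rw [e', sub_self] at hsum1
    have := (Finset.sum_eq_zero_iff_of_nonneg nn1).1 hsum1 u hu
    rcases mul_eq_zero.1 this with q | q
    · linarith
    · rw [e']; linarith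

/-- local partner lemma -/
lemma partner {n : ℕ} {T : Set (Fin n → ℤ)} {lo : Fin n → ℤ} (hT : T ⊆ Set.Icc lo (lo + 1))
    (hE : Exch T) {x : Fin n → ℝ} (hx : x ∈ convexHull ℝ (coeZR '' T)) {i : Fin n}
    (hi : ¬ ∃ z : ℤ, x i = z) :
    (Pi.single i 1 : Fin n → ℝ) ∈ dirs _ (convex_convexHull ℝ (coeZR '' T)) x hx ∨
    ∃ j, j ≠ i ∧ (¬ ∃ z : ℤ, x j = z) ∧
      (Pi.single i 1 - Pi.single j 1 : Fin n → ℝ) ∈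
        dirs _ (convex_convexHull ℝ (coeZR '' T)) x hx := by
  obtain ⟨U, w, hU, hw, h1, h2⟩ := rep hx
  have hU' := hU
  choose! f hf using hU
  have hcoord : ∀ i, ∑ v ∈ U, w v * (f v i : ℝ) = x i := by
    intro i
    rw [← h2, Finset.sum_apply]
    apply Finset.sum_congr rfl
    intro v hv
    rw [Pi.smul_apply, smul_eq_mul]
    rw [show v i = (f v i : ℝ) from (congrFun (hf v hv).2 i).symm]
  have hUn : U.Nonempty := by
    by_contra hc
    rw [Finset.not_nonempty_iff_eq_empty] at hc
    simp [hc] at h1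
  have hst : ∃ s ∈ U, ∃ t ∈ U, f t i < f s i := by
    by_contra hcon
    push Not at hcon
    obtain ⟨u, hu⟩ := hUn
    apply hi
    refine ⟨f u i, ?_⟩
    rw [← hcoord i, Finset.sum_congr rfl (g := fun v => w v * (f u i : ℝ)), ← Finset.sum_mul, h1, one_mul]
    intro v hv
    rw [le_antisymm (hcon u hu v hv) (hcon v hv u hu)]
  obtain ⟨s, hs, t, ht, hlt⟩ := hst
  have hb : ∀ v ∈ U, ∀ i, lo i ≤ f v i ∧ f v i ≤ lo i + 1 := fun v hv i =>
    ⟨(hT (hf v hv).1).1 i, (hT (hf v hv).1).2 i⟩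
  rcases hE _ (hf s hs).1 _ (hf t ht).1 i hlt with ⟨k1, k2⟩ | ⟨j, hj, k1, k2⟩
  · left
    have m1 := move hU' hw h1 hs (Set.mem_image_of_mem coeZR k1)
    have m2 := move hU' hw h1 ht (Set.mem_image_of_mem coeZR k2)
    rw [h2] at m1 m2
    refine mem_dirs_of _ hx (hw t ht) (hw s hs) ?_ ?_
    · convert m2 using 3
      have hq := (hf t ht).2
      ext l; rw [Pi.sub_apply, ← congrFun hq l]; simp [coeZR, Pi.single_apply]
    · convert m1 using 3
      have hq := (hf s hs).2
      ext l; rw [Pi.sub_apply, ← congrFun hq l]; simp [coeZR, Pi.single_apply]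
  · right
    refine ⟨j, by rintro rfl; omega, ?_, ?_⟩
    · rintro ⟨z, hz⟩
      have l1 : (lo j : ℝ) < x j := by
        rw [← hcoord j, show (lo j : ℝ) = ∑ v ∈ U, w v * (lo j : ℝ) by rw [← Finset.sum_mul, h1, one_mul]]
        apply Finset.sum_lt_sum
        · intro v hv
          have : (lo j : ℝ) ≤ f v j := by exact_mod_cast (hb v hv j).1
          exact mul_le_mul_of_nonneg_left this (hw v hv).le
        · refine ⟨t, ht, mul_lt_mul_of_pos_left ?_ (hw t ht)⟩
          have := (hb s hs j).1
          exact_mod_cast (by omega : lo j < f t j)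
      have l2 : x j < ((lo j + 1 : ℤ) : ℝ) := by
        rw [← hcoord j, show ((lo j + 1 : ℤ) : ℝ) = ∑ v ∈ U, w v * ((lo j + 1 : ℤ) : ℝ) by
          rw [← Finset.sum_mul, h1, one_mul]]
        apply Finset.sum_lt_sum
        · intro v hv
          have : (f v j : ℝ) ≤ ((lo j + 1 : ℤ) : ℝ) := by exact_mod_cast (hb v hv j).2
          exact mul_le_mul_of_nonneg_left this (hw v hv).le
        · refine ⟨s, hs, mul_lt_mul_of_pos_left ?_ (hw s hs)⟩
          have := (hb t ht j).2
          exact_mod_cast (by omega : f s j < lo j + 1)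
      rw [hz] at l1 l2
      have l1' : lo j < z := by exact_mod_cast l1
      have l2' : z < lo j + 1 := by exact_mod_cast l2
      omega
    · have m1 := move hU' hw h1 hs (Set.mem_image_of_mem coeZR k1)
      have m2 := move hU' hw h1 ht (Set.mem_image_of_mem coeZR k2)
      rw [h2] at m1 m2
      refine mem_dirs_of _ hx (hw t ht) (hw s hs) ?_ ?_
      · convert m2 using 3
        have hq := (hf t ht).2
        ext l; rw [Pi.sub_apply (coeZR _), ← congrFun hq l]; simp [coeZR, Pi.single_apply]; split_ifs <;> simp
      · convert m1 using 3
        have hq := (hf s hs).2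
        ext l; rw [Pi.sub_apply (coeZR _), ← congrFun hq l]; simp [coeZR, Pi.single_apply]; split_ifs <;> simp

/-- the perturbation -/
lemma perturb {n m : ℕ} (C : Fin m → Set (Fin n → ℝ)) (hC : ∀ k, Convex ℝ (C k))
    (X : Fin m → Fin n → ℝ) (hX : ∀ k, X k ∈ C k)
    (hpart : ∀ k i, (¬ ∃ z : ℤ, X k i = z) →
      (Pi.single i 1 : Fin n → ℝ) ∈ dirs _ (hC k) _ (hX k) ∨
      ∃ j, j ≠ i ∧ (¬ ∃ z : ℤ, X k j = z) ∧
        (Pi.single i 1 - Pi.single j 1 : Fin n → ℝ) ∈ dirs _ (hC k) _ (hX k))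
    (hfrac : ∃ k i, ¬ ∃ z : ℤ, X k i = z) :
    ∃ d : Fin m → Fin n → ℝ, d ≠ 0 ∧ (∀ k, ∀ᶠ t in 𝓝 (0:ℝ), X k + t • d k ∈ C k) ∧
      ∀ i, (∃ z : ℤ, ∑ k, X k i = z) → ∑ k, d k i = 0 := by
  classical
  let E := {e : Fin m × Fin n // ¬ ∃ z : ℤ, X e.1 e.2 = z}
  have : Nonempty E := by
    obtain ⟨k, i, h⟩ := hfrac
    exact ⟨⟨(k, i), h⟩⟩
  let q := fun k => (dirs _ (hC k) _ (hX k)).mkQ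
  let a : E → Σ k, ((Fin n → ℝ) ⧸ dirs _ (hC k) _ (hX k)) :=
    fun e => ⟨e.1.1, q e.1.1 (Pi.single e.1.2 1)⟩
  let b : E → Fin n := fun e => e.1.2
  obtain ⟨d, hd0, hda, hdb⟩ := circ a b {α | α.2 ≠ 0} {i | ∃ z : ℤ, ∑ k, X k i = z} (by
    rintro ⟨⟨k, i⟩, he⟩ h
    rcases hpart k i he with h' | ⟨j, hji, hj, h'⟩
    · exfalso
      apply h
      exact (Submodule.Quotient.mk_eq_zero _).2 h'
    · refine ⟨⟨(k, j), hj⟩, ?_, ?_⟩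
      · intro heq
        apply hji
        have := congrArg (fun e : E => e.1.2) heq
        exact this
      · have : q k (Pi.single j 1) = q k (Pi.single i 1) :=
          ((Submodule.Quotient.eq _).2 h').symm
        simp only [a]
        rw [this]) (by
    rintro ⟨⟨k, i⟩, he⟩ ⟨z, hz⟩
    by_contra hcon
    push Not at hcon
    have hint : ∀ k', k' ≠ k → ∃ z : ℤ, X k' i = z := by
      intro k' hk'
      by_contra hne
      refine hcon ⟨(k', i), hne⟩ ?_ rfl
      intro heq
      exact hk' (congrArg (fun e : E => e.1.1) heq)
    choose! g hg using hint
    apply he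
    refine ⟨z - ∑ k' ∈ Finset.univ.erase k, g k', ?_⟩
    change ∑ k, X k i = z at hz
    rw [← Finset.add_sum_erase _ _ (Finset.mem_univ k)] at hz
    have : ∑ k' ∈ Finset.univ.erase k, X k' i = ∑ k' ∈ Finset.univ.erase k, (g k' : ℝ) :=
      Finset.sum_congr rfl (fun k' hk' => hg k' (Finset.ne_of_mem_erase hk'))
    push_cast
    change X k i = _
    linarith)
  let D : Fin m → Fin n → ℝ := fun k i => if h : ¬ ∃ z : ℤ, X k i = z then d ⟨(k, i), h⟩ else 0
  have hD : ∀ e : E, D e.1.1 e.1.2 = d e := by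
    rintro ⟨⟨k, i⟩, he⟩
    simp only [D]
    rw [dif_pos he]
  have hDn : ∀ k i, (∃ z : ℤ, X k i = z) → D k i = 0 := by
    intro k i h
    simp only [D]
    rw [dif_neg (not_not.2 h)]
  -- sums over E
  have sumE : ∀ {M : Type} [AddCommMonoid M] (F : Fin m × Fin n → M),
      (∀ k i, (∃ z : ℤ, X k i = z) → F (k, i) = 0) → ∑ e : E, F e.1 = ∑ k, ∑ i, F (k, i) := by
    intro M _ F hF
    rw [← Fintype.sum_prod_type]
    rw [← Finset.sum_subtype (Finset.univ.filter
      (fun e : Fin m × Fin n => ¬ ∃ z : ℤ, X e.1 e.2 = z)) (by simp) F]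
    apply Finset.sum_filter_of_ne
    intro e _ h h'
    exact h (hF e.1 e.2 h')
  refine ⟨D, ?_, ?_, ?_⟩
  · intro h0
    apply hd0
    ext e
    rw [← hD e, h0]
    rfl
  · intro k
    change D k ∈ dirs _ (hC k) _ (hX k)
    rw [← Submodule.Quotient.mk_eq_zero]
    change q k (D k) = 0
    have h1 : q k (D k) = ∑ i, D k i • q k (Pi.single i 1) := by
      have h0 : D k = ∑ i, D k i • (Pi.single i 1 : Fin n → ℝ) := by
        ext j
        simp [Finset.sum_apply, Pi.single_apply]
      conv_lhs => rw [h0]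
      simp only [map_sum, map_smul]
    rw [h1]
    -- group by value
    have h2 : ∀ v, v ≠ 0 → ∑ i, (if q k (Pi.single i 1) = v then D k i else 0) = 0 := by
      intro v hv
      have := hda ⟨k, v⟩ hv
      refine Eq.trans ?_ this
      have h3 := sumE (M := ℝ) (fun e => if (⟨e.1, q e.1 (Pi.single e.2 1)⟩ : Σ k, ((Fin n → ℝ) ⧸ dirs _ (hC k) _ (hX k))) = ⟨k, v⟩ then D e.1 e.2 else 0)
        (by intro k i h; simp [hDn k i h])
      simp only [hD] at h3
      refine Eq.trans (Eq.trans ?_ h3.symm) (Finset.sum_congr rfl fun e _ => by congr)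
      rw [Finset.sum_eq_single k]
      · apply Finset.sum_congr rfl
        intro i _
        simp
      · intro k' _ hk'
        apply Finset.sum_eq_zero
        intro i _
        rw [if_neg]
        intro h
        exact hk' (congrArg Sigma.fst h)
      · simp
    rw [← Finset.sum_fiberwise_of_maps_to (t := Finset.univ.image (fun i => q k (Pi.single i 1)))
      (g := fun i => q k (Pi.single i 1)) (fun i _ => Finset.mem_image_of_mem _ (Finset.mem_univ i))]
    apply Finset.sum_eq_zero
    intro v _
    by_cases hv : v = 0
    · apply Finset.sum_eq_zero
      intro i hi
      rw [(Finset.mem_filter.1 hi).2, hv, smul_zero]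
    · rw [Finset.sum_congr rfl (g := fun i => D k i • v)
        (fun i hi => by rw [(Finset.mem_filter.1 hi).2]), ← Finset.sum_smul, Finset.sum_filter,
        h2 v hv, zero_smul]
  · intro i hi
    have := hdb i hi
    refine Eq.trans ?_ this
    have h3 := sumE (M := ℝ) (fun e => if e.2 = i then D e.1 e.2 else 0)
        (by intro k i h; simp [hDn k i h])
    simp only [hD] at h3
    refine Eq.trans (Eq.trans ?_ h3.symm) (Finset.sum_congr rfl fun e _ => by congr)
    simp

/-- rounding lemma: extreme points of the coupled polytope are integral -/
lemma exists_int {n m : ℕ} (T : Fin m → Set (Fin n → ℤ)) (lo : Fin m → Fin n → ℤ)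
    (hT : ∀ k, T k ⊆ Set.Icc (lo k) (lo k + 1)) (hE : ∀ k, Exch (T k))
    (X : Fin m → Fin n → ℝ) (hX : ∀ k, X k ∈ convexHull ℝ (coeZR '' T k))
    (α β : Fin n → ℝ) :
    ∃ z : Fin m → Fin n → ℤ, (∀ k, z k ∈ T k) ∧
      (∀ i, ⌊∑ k, X k i⌋ ≤ ∑ k, z k i ∧ ∑ k, z k i ≤ ⌈∑ k, X k i⌉) ∧
      ∑ i, (α i * ((∑ k, z k i : ℤ) : ℝ) + β i) ≤ ∑ i, (α i * (∑ k, X k i) + β i) := by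
  classical
  set C : Fin m → Set (Fin n → ℝ) := fun k => convexHull ℝ (coeZR '' T k) with hCdef
  have hC : ∀ k, Convex ℝ (C k) := fun k => convex_convexHull ℝ _
  have hCc : ∀ k, IsCompact (C k) := fun k =>
    (((Set.finite_Icc (lo k) (lo k + 1)).subset (hT k)).image coeZR).isCompact_convexHull ℝ
  let ell : (Fin m → Fin n → ℝ) → ℝ := fun Y => ∑ i, (α i * (∑ k, Y k i) + β i)
  have hell : Continuous ell := by fun_prop
  let P : Set (Fin m → Fin n → ℝ) := Set.univ.pi C ∩
    {Y | ∀ i, (⌊∑ k, X k i⌋ : ℝ) ≤ ∑ k, Y k i ∧ ∑ k, Y k i ≤ (⌈∑ k, X k i⌉ : ℝ)}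
  have hPc : IsCompact P := by
    apply (isCompact_univ_pi hCc).inter_right
    simp only [Set.ofPred_forall]
    apply isClosed_iInter
    intro i
    have hc : Continuous (fun Y : Fin m → Fin n → ℝ => ∑ k, Y k i) := by fun_prop
    exact (isClosed_le continuous_const hc).inter (isClosed_le hc continuous_const)
  have hXP : X ∈ P := ⟨fun k _ => hX k, fun i => ⟨Int.floor_le _, Int.le_ceil _⟩⟩
  obtain ⟨Y0, hY0, hmin⟩ := hPc.exists_isMinOn ⟨X, hXP⟩ hell.continuousOn
  let M := P ∩ {Y | ell Y ≤ ell Y0}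
  have hMc : IsCompact M := hPc.inter_right (isClosed_le hell continuous_const)
  obtain ⟨Y, hY⟩ := hMc.extremePoints_nonempty ⟨Y0, hY0, le_refl (ell Y0)⟩
  rw [mem_extremePoints] at hY
  obtain ⟨⟨⟨hYC, hYb⟩, hYl⟩, hext⟩ := hY
  have hYC' : ∀ k, Y k ∈ C k := fun k => hYC k (Set.mem_univ k)
  have hint : ∀ k i, ∃ z : ℤ, Y k i = z := by
    by_contra hcon
    push Not at hcon
    obtain ⟨d, hd0, hd1, hd2⟩ := perturb C hC Y hYC'
      (fun k i h => partner (hT k) (hE k) (hYC' k) h)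
      (by obtain ⟨k, i, h⟩ := hcon; exact ⟨k, i, by push Not; exact h⟩)
    have ev1 : ∀ᶠ t in 𝓝 (0:ℝ), ∀ k, Y k + t • d k ∈ C k := eventually_all.2 hd1
    have ev2 : ∀ᶠ t in 𝓝 (0:ℝ), ∀ i, (⌊∑ k, X k i⌋ : ℝ) ≤ ∑ k, (Y k i + t * d k i) ∧
        ∑ k, (Y k i + t * d k i) ≤ (⌈∑ k, X k i⌉ : ℝ) := by
      refine eventually_all.2 fun i => ?_
      by_cases hi : ∃ z : ℤ, ∑ k, Y k i = z
      · have h0 := hd2 i hi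
        refine Eventually.of_forall fun t => ?_
        rw [Finset.sum_add_distrib, ← Finset.mul_sum, h0, mul_zero, add_zero]
        exact hYb i
      · have l1 : (⌊∑ k, X k i⌋ : ℝ) < ∑ k, Y k i :=
          lt_of_le_of_ne (hYb i).1 (fun h => hi ⟨_, h.symm⟩)
        have l2 : ∑ k, Y k i < (⌈∑ k, X k i⌉ : ℝ) :=
          lt_of_le_of_ne (hYb i).2 (fun h => hi ⟨_, h⟩)
        have hc : Tendsto (fun t : ℝ => ∑ k, (Y k i + t * d k i)) (𝓝 0) (𝓝 (∑ k, Y k i)) := by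
          have : Continuous (fun t : ℝ => ∑ k, (Y k i + t * d k i)) := by fun_prop
          simpa using this.tendsto 0
        filter_upwards [hc.eventually (lt_mem_nhds l1), hc.eventually (gt_mem_nhds l2)] with t q1 q2
        exact ⟨q1.le, q2.le⟩
    have ev : ∀ᶠ t in 𝓝 (0:ℝ), Y + t • d ∈ P := by
      filter_upwards [ev1, ev2] with t q1 q2
      exact ⟨fun k _ => q1 k, q2⟩
    obtain ⟨ε, hε, hball⟩ := Metric.eventually_nhds_iff.1 ev
    have p1 : Y + (ε/2) • d ∈ P := hball (by rw [Real.dist_eq, sub_zero, abs_of_pos] <;> linarith)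
    have p2 : Y + (-(ε/2)) • d ∈ P :=
      hball (by rw [Real.dist_eq, sub_zero, abs_neg, abs_of_pos] <;> linarith)
    have hlin : ∀ t : ℝ, ell (Y + t • d) = ell Y + t * ∑ i, α i * ∑ k, d k i := by
      intro t
      simp only [ell, Pi.add_apply, Pi.smul_apply, smul_eq_mul, Finset.sum_add_distrib,
        ← Finset.mul_sum, mul_add]
      rw [Finset.mul_sum (a := t)]
      have : ∀ i, α i * (t * ∑ k, d k i) = t * (α i * ∑ k, d k i) := fun i => by ring
      simp only [this]
      ring
    have m1 := hmin p1
    have m2 := hmin p2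
    have m3 : ell Y0 ≤ ell Y := hmin ⟨hYC, hYb⟩
    simp only [Set.mem_ofPred_eq] at m1 m2 hYl
    rw [hlin] at m1 m2
    have := (hext _ ⟨p1, by simp only [Set.mem_ofPred_eq]; rw [hlin]; linarith⟩ _
      ⟨p2, by simp only [Set.mem_ofPred_eq]; rw [hlin]; linarith⟩
      ⟨1/2, 1/2, by norm_num, by norm_num, by norm_num, by module⟩).1
    apply hd0
    have h0 : (ε/2) • d = 0 := by simpa using this
    rcases smul_eq_zero.1 h0 with h | h
    · linarith
    · exact h
  choose z hzT hz using fun k => vtx (hT k) (hYC' k) (hint k)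
  have hsum : ∀ i, ∑ k, Y k i = ((∑ k, z k i : ℤ) : ℝ) := by
    intro i
    push_cast
    exact Finset.sum_congr rfl fun k _ => (congrFun (hz k) i).symm
  refine ⟨z, hzT, ?_, ?_⟩
  · intro i
    have := hYb i
    rw [hsum i] at this
    exact ⟨by exact_mod_cast this.1, by exact_mod_cast this.2⟩
  · have h1 : ell Y ≤ ell X := le_trans hYl (hmin hXP)
    simp only [ell, hsum] at h1
    exact h1

/-- Shapley–Folkman-type theorem for M♮-convex sets. -/
theorem stmt12 {n m : ℕ} (hn : 2 ≤ n) (hm : 1 ≤ m)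
    (S : Fin m → Set (Fin n → ℤ)) (hS : ∀ i, MnatConvex (S i))
    (x : Fin n → ℝ) (hx : x ∈ convexHull ℝ (coeZR '' minkSumZ S)) :
    ∃ z ∈ minkSumZ S, ‖x - coeZR z‖ ≤ 1 - 1 / n := by
  classical
  have hdec : ∃ X : Fin m → Fin n → ℝ, (∀ k, X k ∈ convexHull ℝ (coeZR '' S k)) ∧ x = ∑ k, X k := by
    have hconv : Convex ℝ {y : Fin n → ℝ | ∃ X : Fin m → Fin n → ℝ,
        (∀ k, X k ∈ convexHull ℝ (coeZR '' S k)) ∧ y = ∑ k, X k} := by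
      rintro _ ⟨X, hX, rfl⟩ _ ⟨Y, hY, rfl⟩ a b ha hb hab
      refine ⟨fun k => a • X k + b • Y k,
        fun k => convex_convexHull ℝ _ (hX k) (hY k) ha hb hab, ?_⟩
      rw [Finset.sum_add_distrib, Finset.smul_sum, Finset.smul_sum]
    refine convexHull_min ?_ hconv hx
    rintro _ ⟨_, ⟨z, hz, rfl⟩, rfl⟩
    refine ⟨fun k => coeZR (z k), fun k => subset_convexHull ℝ _ ⟨z k, hz k, rfl⟩, ?_⟩
    ext i
    simp [coeZR, Finset.sum_apply]
  obtain ⟨X, hX, rfl⟩ := hdec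
  choose lo hlo using fun k => unit_cube (hS k).2 (hX k)
  have hn0 : (0:ℝ) < n := by exact_mod_cast (by omega : 0 < n)
  have hn2 : (2:ℝ) ≤ n := by exact_mod_cast hn
  have hinv : (1:ℝ) / n ≤ 1 / 2 := one_div_le_one_div_of_le (by norm_num) hn2
  have hinv0 : (0:ℝ) < 1 / n := by positivity
  let s : Fin n → ℝ := fun i => ∑ k, X k i
  let α : Fin n → ℝ := fun i => if s i - ⌊s i⌋ < 1 / n then 1 else if ⌈s i⌉ - s i < 1 / n then -1 else 0
  let β : Fin n → ℝ := fun i => if s i - ⌊s i⌋ < 1 / n then -⌊s i⌋ else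
    if ⌈s i⌉ - s i < 1 / n then ⌈s i⌉ else 0
  obtain ⟨z, hzT, hzb, hzl⟩ := exists_int (fun k => S k ∩ Set.Icc (lo k) (lo k + 1)) lo
    (fun k => Set.inter_subset_right) (fun k => Exch.box (hS k).2 _ _) X hlo α β
  refine ⟨∑ k, z k, ⟨z, fun k => (hzT k).1, rfl⟩, ?_⟩
  have hlt : ∑ i, (α i * s i + β i) < 1 := by
    have hne : (Finset.univ : Finset (Fin n)).Nonempty := ⟨⟨0, by omega⟩, Finset.mem_univ _⟩
    have : ∑ i : Fin n, (α i * s i + β i) < ∑ i : Fin n, (1:ℝ) / n := by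
      apply Finset.sum_lt_sum_of_nonempty hne
      intro i _
      simp only [α, β]
      split_ifs <;> linarith
    simp at this
    rwa [mul_inv_cancel₀ hn0.ne'] at this
  have hnn : ∀ i, 0 ≤ α i * ((∑ k, z k i : ℤ) : ℝ) + β i := by
    intro i
    have h1 : (⌊s i⌋ : ℝ) ≤ ((∑ k, z k i : ℤ) : ℝ) := by exact_mod_cast (hzb i).1
    have h2 : ((∑ k, z k i : ℤ) : ℝ) ≤ (⌈s i⌉ : ℝ) := by exact_mod_cast (hzb i).2
    simp only [α, β]
    split_ifs <;> linarith
  rw [pi_norm_le_iff_of_nonneg (by linarith)]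
  intro i
  have hterm : α i * ((∑ k, z k i : ℤ) : ℝ) + β i < 1 :=
    lt_of_le_of_lt (Finset.single_le_sum (f := fun i => α i * ((∑ k, z k i : ℤ) : ℝ) + β i)
      (fun i _ => hnn i) (Finset.mem_univ i)) (lt_of_le_of_lt hzl hlt)
  have h1 : ⌊s i⌋ ≤ ∑ k, z k i := (hzb i).1
  have h2 : ∑ k, z k i ≤ ⌈s i⌉ := (hzb i).2
  have h3 : ⌈s i⌉ ≤ ⌊s i⌋ + 1 := Int.ceil_le_floor_add_one _
  have hval : (∑ k, X k - coeZR (∑ k, z k)) i = s i - ((∑ k, z k i : ℤ) : ℝ) := by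
    simp [coeZR, Finset.sum_apply, s]
  rw [hval, Real.norm_eq_abs]
  have f1 := Int.floor_le (s i)
  have f2 := Int.le_ceil (s i)
  generalize (∑ k, z k i) = w at *
  have h3' : (⌈s i⌉ : ℝ) ≤ ⌊s i⌋ + 1 := by exact_mod_cast h3
  simp only [α, β] at hterm
  split_ifs at hterm with c1 c2
  · have : w < ⌊s i⌋ + 1 := by exact_mod_cast (by linarith : (w : ℝ) < ⌊s i⌋ + 1)
    have : w = ⌊s i⌋ := by omega
    rw [this, abs_of_nonneg] <;> linarith
  · have : ⌈s i⌉ < w + 1 := by exact_mod_cast (by linarith : (⌈s i⌉ : ℝ) < w + 1)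
    have : w = ⌈s i⌉ := by omega
    rw [this, abs_of_nonpos] <;> linarith
  · push Not at c1 c2
    have g1 : (⌊s i⌋ : ℝ) ≤ w := by exact_mod_cast h1
    have g2 : (w : ℝ) ≤ ⌈s i⌉ := by exact_mod_cast h2
    rw [abs_le]
    constructor <;> linarith
end
end

section
/- Let S_1, …, S_m be L♮-convex subsets of ℤ^n with n ≥ 2, and W = S_1 + ⋯ + S_m. For any x ∈ conv(W), there exists z ∈ W with ‖x − z‖_∞ ≤ (1 − 1/n)·min(n, ⌈m/2⌉). -/
open scoped BigOperators Pointwise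

noncomputable section

/-- L♮-convexity via discrete midpoint convexity (componentwise roundings). -/
def LnatConvex {n : ℕ} (S : Set (Fin n → ℤ)) : Prop :=
  S.Nonempty ∧ ∀ x ∈ S, ∀ y ∈ S,
    (fun i => ⌈((x i + y i : ℚ)) / 2⌉) ∈ S ∧ (fun i => ⌊((x i + y i : ℚ)) / 2⌋) ∈ S

/-- Midpoint closure in integer arithmetic. -/
def MidC {n : ℕ} (S : Set (Fin n → ℤ)) : Prop :=
  ∀ x ∈ S, ∀ y ∈ S, (fun i => (x i + y i + 1) / 2) ∈ S ∧ (fun i => (x i + y i) / 2) ∈ S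

lemma LnatConvex.midC {n : ℕ} {S : Set (Fin n → ℤ)} (h : LnatConvex S) : MidC S := by
  intro x hx y hy
  obtain ⟨h1, h2⟩ := h.2 x hx y hy
  constructor
  · convert h1 using 2 with i
    symm
    rw [Int.ceil_eq_iff]
    have a : (2 * ((x i + y i + 1) / 2) : ℤ) ≤ x i + y i + 1 := by omega
    have b : x i + y i ≤ (2 * ((x i + y i + 1) / 2) : ℤ) := by omega
    have a' : (2 * (((x i + y i + 1) / 2 : ℤ) : ℚ)) ≤ x i + y i + 1 := by exact_mod_cast a
    have b' : (x i + y i : ℚ) ≤ (2 * (((x i + y i + 1) / 2 : ℤ) : ℚ)) := by exact_mod_cast b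
    constructor <;> linarith
  · convert h2 using 2 with i
    symm
    rw [Int.floor_eq_iff]
    have a : (2 * ((x i + y i) / 2) : ℤ) ≤ x i + y i := by omega
    have b : x i + y i ≤ (2 * ((x i + y i) / 2) : ℤ) + 1 := by omega
    have a' : (2 * (((x i + y i) / 2 : ℤ) : ℚ)) ≤ x i + y i := by exact_mod_cast a
    have b' : (x i + y i : ℚ) ≤ (2 * (((x i + y i) / 2 : ℤ) : ℚ)) + 1 := by exact_mod_cast b
    constructor <;> linarith

lemma MidC.neg {n : ℕ} {S : Set (Fin n → ℤ)} (h : MidC S) : MidC {x | -x ∈ S} := by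
  intro x hx y hy
  obtain ⟨h1, h2⟩ := h _ hx _ hy
  constructor
  · show -(fun i => (x i + y i + 1) / 2) ∈ S
    convert h2 using 1
    funext i
    simp only [Pi.neg_apply]
    omega
  · show -(fun i => (x i + y i) / 2) ∈ S
    convert h1 using 1
    funext i
    simp only [Pi.neg_apply]
    omega

lemma MidC.step_aux {n : ℕ} {S : Set (Fin n → ℤ)} (h : MidC S) (p : Fin n → ℤ) (hp : p ∈ S)
    (N : ℕ) : ∀ q ∈ S, (∑ i, (q i - p i).natAbs) ≤ N → ∀ M : ℤ, 1 ≤ M → (∀ i, q i - p i ≤ M) →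
      (fun i => max (p i) (q i - (M - 1))) ∈ S := by
  induction N with
  | zero =>
    intro q hq hN M hM hle
    have h0 : ∀ i, (q i - p i).natAbs = 0 := by
      have := Finset.sum_eq_zero_iff.1 (Nat.le_zero.1 hN)
      intro i; exact this i (Finset.mem_univ i)
    convert hp using 1
    funext i
    have := h0 i
    omega
  | succ N ih =>
    intro q hq hN M hM hle
    by_cases hatt : ∃ i, q i - p i = M
    swap
    · convert hp using 1
      funext i
      have h1 := hle i
      have h2 : q i - p i ≠ M := fun hh => hatt ⟨i, hh⟩
      omega
    obtain ⟨i0, hi0⟩ := hatt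
    -- a general reduction
    have key : ∀ q' ∈ S, (∀ i, (q' i - p i).natAbs ≤ (q i - p i).natAbs) →
        (∃ i, (q' i - p i).natAbs < (q i - p i).natAbs) → ∀ M' : ℤ, 1 ≤ M' →
        (∀ i, q' i - p i ≤ M') →
        (∀ i, max (p i) (q' i - (M' - 1)) = max (p i) (q i - (M - 1))) →
        (fun i => max (p i) (q i - (M - 1))) ∈ S := by
      intro q' hq' hl ⟨j, hj⟩ M' hM' hle' heq
      have hlt : (∑ i, (q' i - p i).natAbs) < ∑ i, (q i - p i).natAbs :=
        Finset.sum_lt_sum (fun i _ => hl i) ⟨j, Finset.mem_univ j, hj⟩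
      have := ih q' hq' (by omega) M' hM' hle'
      simpa only [heq] using this
    by_cases hM1 : M = 1
    · subst hM1
      by_cases hneg : ∃ j, q j - p j < 0
      · obtain ⟨j, hj⟩ := hneg
        refine key _ (h p hp q hq).1 ?_ ⟨j, ?_⟩ 1 le_rfl ?_ ?_
        · intro i; have := hle i; omega
        · omega
        · intro i; have := hle i; omega
        · intro i; have := hle i; omega
      · convert hq using 1
        funext i
        have h2 : ¬ (q i - p i < 0) := fun hh => hneg ⟨i, hh⟩
        omega
    · rcases Int.even_or_odd' M with ⟨k, hk | hk⟩
      · refine key _ (h p hp q hq).2 ?_ ⟨i0, ?_⟩ k (by omega) ?_ ?_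
        · intro i; have := hle i; omega
        · omega
        · intro i; have := hle i; omega
        · intro i; have := hle i; omega
      · refine key _ (h p hp q hq).1 ?_ ⟨i0, ?_⟩ (k + 1) (by omega) ?_ ?_
        · intro i; have := hle i; omega
        · omega
        · intro i; have := hle i; omega
        · intro i; have := hle i; omega

lemma MidC.join_aux {n : ℕ} {S : Set (Fin n → ℤ)} (h : MidC S) (q : Fin n → ℤ) (hq : q ∈ S)
    (a : ℤ) (ha : 0 ≤ a) (K : ℕ) : ∀ p ∈ S, (∀ i, q i - p i ≤ a + K) →
      (fun i => max (p i) (q i - a)) ∈ S := by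
  induction K with
  | zero =>
    intro p hp hle
    convert hp using 1
    funext i
    have := hle i
    push_cast at this
    omega
  | succ K ih =>
    intro p hp hle
    have h1 := h.step_aux p hp _ q hq le_rfl (a + K + 1) (by omega)
      (fun i => by have := hle i; push_cast at this; omega)
    have h2 := ih _ h1 (fun i => by omega)
    convert h2 using 1
    funext i
    omega

lemma MidC.join {n : ℕ} {S : Set (Fin n → ℤ)} (h : MidC S) (p q : Fin n → ℤ) (hp : p ∈ S)
    (hq : q ∈ S) (a : ℤ) (ha : 0 ≤ a) : (fun i => max (p i) (q i - a)) ∈ S := by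
  refine h.join_aux q hq a ha (∑ i, (q i - p i).natAbs) p hp fun i => ?_
  have : (q i - p i).natAbs ≤ ∑ i, (q i - p i).natAbs :=
    Finset.single_le_sum (f := fun i => (q i - p i).natAbs) (fun _ _ => Nat.zero_le _)
      (Finset.mem_univ i)
  omega

lemma MidC.meet {n : ℕ} {S : Set (Fin n → ℤ)} (h : MidC S) (p q : Fin n → ℤ) (hp : p ∈ S)
    (hq : q ∈ S) (a : ℤ) (ha : 0 ≤ a) : (fun i => min (p i) (q i + a)) ∈ S := by
  have := h.neg.join (-p) (-q) (by simpa using hp) (by simpa using hq) a ha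
  have h2 : -(fun i => max ((-p) i) ((-q) i - a)) ∈ S := this
  convert h2 using 1
  funext i
  simp only [Pi.neg_apply]
  omega

/-- Homogenization of `S`. -/
def homog {n : ℕ} (S : Set (Fin n → ℤ)) : Set (Option (Fin n) → ℤ) :=
  {u | (fun i => u (some i) - u none) ∈ S}

lemma MidC.homog_sup {n : ℕ} {S : Set (Fin n → ℤ)} (h : MidC S) (u v : Option (Fin n) → ℤ)
    (hu : u ∈ homog S) (hv : v ∈ homog S) : u ⊔ v ∈ homog S := by
  show (fun i => (u ⊔ v) (some i) - (u ⊔ v) none) ∈ S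
  rcases le_total (v none) (u none) with hl | hl
  · have := h.join _ _ hu hv (u none - v none) (by omega)
    convert this using 1
    funext i
    simp only [Pi.sup_apply]
    omega
  · have := h.join _ _ hv hu (v none - u none) (by omega)
    convert this using 1
    funext i
    simp only [Pi.sup_apply]
    omega

lemma MidC.homog_inf {n : ℕ} {S : Set (Fin n → ℤ)} (h : MidC S) (u v : Option (Fin n) → ℤ)
    (hu : u ∈ homog S) (hv : v ∈ homog S) : u ⊓ v ∈ homog S := by
  show (fun i => (u ⊓ v) (some i) - (u ⊓ v) none) ∈ S
  rcases le_total (v none) (u none) with hl | hl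
  · have := h.meet _ _ hv hu (u none - v none) (by omega)
    convert this using 1
    funext i
    simp only [Pi.inf_apply]
    omega
  · have := h.meet _ _ hu hv (v none - u none) (by omega)
    convert this using 1
    funext i
    simp only [Pi.inf_apply]
    omega

lemma MidC.homog_mem {n : ℕ} {S : Set (Fin n → ℤ)} (h : MidC S) (z : Option (Fin n) → ℤ)
    (hz : ∀ i j, ∃ u ∈ homog S, u j - u i ≤ z j - z i) : z ∈ homog S := by
  have hz' : ∀ i j, ∃ u ∈ homog S, u i = z i ∧ u j ≤ z j := by
    intro i j
    obtain ⟨u, hu, hle⟩ := hz i j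
    refine ⟨fun k => u k + (z i - u i), ?_, by dsimp only; omega, by dsimp only; omega⟩
    show (fun k => (u (some k) + (z i - u i)) - (u none + (z i - u i))) ∈ S
    convert hu using 1
    simp only [add_sub_add_right_eq_sub]
    rfl
  choose f hf1 hf2 hf3 using hz'
  let g : Option (Fin n) → (Option (Fin n) → ℤ) := fun i =>
    Finset.univ.inf' Finset.univ_nonempty (f i)
  have hg : ∀ i, g i ∈ homog S := fun i =>
    Finset.inf'_induction (p := fun u => u ∈ homog S) Finset.univ_nonempty (f i)
      (fun a ha b hb => h.homog_inf a b ha hb) (fun j _ => hf1 i j)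
  have hk : Finset.univ.sup' Finset.univ_nonempty g ∈ homog S :=
    Finset.sup'_induction (p := fun u => u ∈ homog S) Finset.univ_nonempty g
      (fun a ha b hb => h.homog_sup a b ha hb) (fun j _ => hg j)
  have heq : z = Finset.univ.sup' Finset.univ_nonempty g := by
    apply le_antisymm
    · intro i
      have h1 : g i ≤ Finset.univ.sup' Finset.univ_nonempty g :=
        Finset.le_sup' g (Finset.mem_univ i)
      refine le_trans ?_ (h1 i)
      simp only [g, Finset.inf'_apply]
      exact Finset.le_inf' _ _ fun j _ => (hf2 i j).ge
    · refine Finset.sup'_le _ _ fun i _ j => ?_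
      have : g i ≤ f i j := Finset.inf'_le (f i) (Finset.mem_univ j)
      exact (this j).trans (hf3 i j)
  rw [heq]; exact hk

/-- Extension by `0`. -/
def ext0 {n : ℕ} {R : Type} [Zero R] (x : Fin n → R) : Option (Fin n) → R := fun o => o.elim 0 x

lemma exists_le_of_hull {n : ℕ} {S : Set (Fin n → ℤ)} {x : Fin n → ℝ}
    (hx : x ∈ convexHull ℝ (coeZR '' S)) (i j : Option (Fin n)) :
    ∃ s ∈ S, ((ext0 s j : ℤ) : ℝ) - (ext0 s i : ℤ) ≤ ext0 x j - ext0 x i := by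
  by_contra! hcon
  have hconv : Convex ℝ {y : Fin n → ℝ | ext0 x j - ext0 x i < ext0 y j - ext0 y i} := by
    apply convex_halfSpace_gt (f := fun y : Fin n → ℝ => ext0 y j - ext0 y i)
    constructor
    · intro a b; cases i <;> cases j <;> simp [ext0] <;> ring
    · intro a b; cases i <;> cases j <;> simp [ext0] <;> ring
  have hsub : coeZR '' S ⊆ {y : Fin n → ℝ | ext0 x j - ext0 x i < ext0 y j - ext0 y i} := by
    rintro _ ⟨s, hs, rfl⟩
    have := hcon s hs
    rw [Set.mem_ofPred_eq]
    have e : ∀ k, ext0 (coeZR s) k = ((ext0 s k : ℤ) : ℝ) := by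
      intro k; cases k <;> simp [ext0, coeZR]
    rw [e, e]
    exact this
  have := convexHull_min hsub hconv hx
  rw [Set.mem_ofPred_eq] at this
  exact lt_irrefl _ this

lemma MidC.floor_mem {n : ℕ} {S : Set (Fin n → ℤ)} (h : MidC S) {x : Fin n → ℝ}
    (hx : x ∈ convexHull ℝ (coeZR '' S)) {t : ℝ} (ht : 0 ≤ t) (ht1 : t < 1) :
    (fun i => ⌊x i + t⌋) ∈ S := by
  have h0 : ⌊t⌋ = 0 := by rw [Int.floor_eq_zero_iff]; exact ⟨ht, ht1⟩
  have : (fun o => ⌊ext0 x o + t⌋) ∈ homog S := by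
    apply h.homog_mem
    intro i j
    obtain ⟨s, hs, hle⟩ := exists_le_of_hull hx i j
    refine ⟨ext0 s, ?_, ?_⟩
    · show (fun k => ext0 s (some k) - ext0 s none) ∈ S
      simpa [ext0] using hs
    · have : (ext0 s j - ext0 s i) + ⌊ext0 x i + t⌋ ≤ ⌊ext0 x j + t⌋ := by
        rw [Int.le_floor]
        push_cast
        have := Int.floor_le (ext0 x i + t)
        linarith
      linarith
  have h2 : (fun i => ⌊ext0 x (some i) + t⌋ - ⌊ext0 x none + t⌋) ∈ S := this
  simpa [ext0, h0] using h2

lemma MidC.ceil_mem {n : ℕ} {S : Set (Fin n → ℤ)} (h : MidC S) {x : Fin n → ℝ}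
    (hx : x ∈ convexHull ℝ (coeZR '' S)) {t : ℝ} (ht : 0 ≤ t) (ht1 : t < 1) :
    (fun i => ⌈x i - t⌉) ∈ S := by
  have hx' : -x ∈ convexHull ℝ (coeZR '' {x | -x ∈ S}) := by
    have : coeZR '' {x | -x ∈ S} = -(coeZR '' S) := by
      ext y
      simp only [Set.mem_image, Set.mem_neg, Set.mem_ofPred_eq]
      constructor
      · rintro ⟨s, hs, rfl⟩
        exact ⟨-s, hs, by funext i; simp [coeZR]⟩
      · rintro ⟨s, hs, hy⟩
        refine ⟨-s, by simpa using hs, ?_⟩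
        rw [← neg_neg y, ← hy]
        funext i; simp [coeZR]
    rw [this, convexHull_neg]
    simpa using hx
  have h1 : -(fun i => ⌊(-x) i + t⌋) ∈ S := h.neg.floor_mem hx' ht ht1
  convert h1 using 1
  funext i
  simp only [Pi.neg_apply]
  rw [← Int.ceil_neg]
  congr 1
  ring

open MeasureTheory in
lemma bad_measure (a b : ℝ) (r : ℝ) (hr : 0 < r) (hr2 : r ≤ 1 / 2) :
    volume {t : ℝ | t ∈ Set.Ico (0:ℝ) 1 ∧
      1 - r < |a + b - ((⌊a + t⌋ + ⌈b - t⌉ : ℤ) : ℝ)|} < ENNReal.ofReal r := by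
  set α := a - ⌊a⌋ with hα
  set β := (⌈b⌉ : ℝ) - b with hβ
  have hα0 : 0 ≤ α := by have := Int.floor_le a; linarith
  have hα1 : α < 1 := by have := Int.lt_floor_add_one a; linarith
  have hβ0 : 0 ≤ β := by have := Int.le_ceil b; linarith
  have hβ1 : β < 1 := by have := Int.ceil_lt_add_one b; linarith
  have f1 : ∀ t ∈ Set.Ico (0:ℝ) 1, ⌊a + t⌋ = ⌊a⌋ + if 1 - α ≤ t then 1 else 0 := by
    intro t ht
    rw [Int.floor_eq_iff]
    split_ifs with hc <;> push_cast <;> constructor <;> linarith [ht.1, ht.2]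
  have f2 : ∀ t ∈ Set.Ico (0:ℝ) 1, ⌈b - t⌉ = ⌈b⌉ - if 1 - β ≤ t then 1 else 0 := by
    intro t ht
    rw [Int.ceil_eq_iff]
    split_ifs with hc <;> push_cast <;> constructor <;> linarith [ht.1, ht.2]
  have key : ∀ t ∈ Set.Ico (0:ℝ) 1, a + b - ((⌊a + t⌋ + ⌈b - t⌉ : ℤ) : ℝ)
      = α - β - (if 1 - α ≤ t then 1 else 0) + (if 1 - β ≤ t then 1 else 0) := by
    intro t ht
    rw [f1 t ht, f2 t ht]
    push_cast
    rw [hα, hβ]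
    ring
  by_cases hsmall : |α - β| < r
  · -- bad set inside the interval between
    have hsub : {t : ℝ | t ∈ Set.Ico (0:ℝ) 1 ∧
      1 - r < |a + b - ((⌊a + t⌋ + ⌈b - t⌉ : ℤ) : ℝ)|} ⊆
        Set.Ico (min (1 - α) (1 - β)) (max (1 - α) (1 - β)) := by
      rintro t ⟨ht, hb⟩
      rw [key t ht] at hb
      have hs := abs_lt.1 hsmall
      simp only [Set.mem_Ico, min_le_iff, lt_max_iff]
      split_ifs at hb with h1 h2 h2
      · rw [show α - β - 1 + 1 = α - β by ring] at hb; linarith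
      · exact ⟨Or.inl h1, Or.inr (not_le.1 h2)⟩
      · exact ⟨Or.inr h2, Or.inl (not_le.1 h1)⟩
      · rw [show α - β - 0 + 0 = α - β by ring] at hb; linarith
    refine (measure_mono hsub).trans_lt ?_
    rw [Real.volume_Ico, ENNReal.ofReal_lt_ofReal_iff hr]
    rw [max_sub_min_eq_abs]
    convert hsmall using 1
    congr 1; ring
  by_cases hbig : 1 - r < |α - β|
  · have hsub : {t : ℝ | t ∈ Set.Ico (0:ℝ) 1 ∧
      1 - r < |a + b - ((⌊a + t⌋ + ⌈b - t⌉ : ℤ) : ℝ)|} ⊆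
        Set.Ico 0 (min (1 - α) (1 - β)) ∪ Set.Ico (max (1 - α) (1 - β)) 1 := by
      rintro t ⟨ht, hb⟩
      rw [key t ht] at hb
      simp only [Set.mem_Ico, Set.mem_union, lt_min_iff, max_le_iff]
      split_ifs at hb with h1 h2 h2
      · exact Or.inr ⟨⟨h1, h2⟩, ht.2⟩
      · exfalso
        rcases abs_cases (α - β) with hh | hh <;> rcases lt_abs.1 hb with hb | hb <;> linarith
      · exfalso
        rcases abs_cases (α - β) with hh | hh <;> rcases lt_abs.1 hb with hb | hb <;> linarith
      · exact Or.inl ⟨ht.1, not_le.1 h1, not_le.1 h2⟩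
    refine (measure_mono hsub).trans_lt ((measure_union_le _ _).trans_lt ?_)
    rw [Real.volume_Ico, Real.volume_Ico, ← ENNReal.ofReal_add, ENNReal.ofReal_lt_ofReal_iff hr]
    · have := max_sub_min_eq_abs (1 - α) (1 - β)
      rw [show 1 - β - (1 - α) = α - β by ring] at this
      linarith
    · rw [sub_zero]; exact le_min (by linarith) (by linarith)
    · rw [sub_nonneg]; exact max_le (by linarith) (by linarith)
  · have hsub : {t : ℝ | t ∈ Set.Ico (0:ℝ) 1 ∧
      1 - r < |a + b - ((⌊a + t⌋ + ⌈b - t⌉ : ℤ) : ℝ)|} = ∅ := by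
      rw [Set.eq_empty_iff_forall_notMem]
      rintro t ⟨ht, hb⟩
      rw [key t ht] at hb
      split_ifs at hb with h1 h2 h2
      all_goals
        rcases abs_cases (α - β) with hh | hh <;> rcases lt_abs.1 hb with hb | hb <;> linarith
    rw [hsub, measure_empty]
    exact ENNReal.ofReal_pos.2 hr

open MeasureTheory in
lemma exists_good_t {n : ℕ} (hn : 2 ≤ n) (x y : Fin n → ℝ) :
    ∃ t : ℝ, 0 ≤ t ∧ t < 1 ∧
      ∀ i, |x i + y i - ((⌊x i + t⌋ + ⌈y i - t⌉ : ℤ) : ℝ)| ≤ 1 - 1 / n := by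
  have hn' : (2:ℝ) ≤ n := by exact_mod_cast hn
  have hr : (0:ℝ) < 1 / n := by positivity
  have hr2 : (1:ℝ) / n ≤ 1 / 2 := one_div_le_one_div_of_le (by norm_num) hn'
  by_contra! hcon
  have hcov : Set.Ico (0:ℝ) 1 ⊆ ⋃ i : Fin n, {t : ℝ | t ∈ Set.Ico (0:ℝ) 1 ∧
      1 - 1 / n < |x i + y i - ((⌊x i + t⌋ + ⌈y i - t⌉ : ℤ) : ℝ)|} := by
    intro t ht
    obtain ⟨i, hi⟩ := hcon t ht.1 ht.2
    exact Set.mem_iUnion.2 ⟨i, ht, hi⟩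
  have h1 := measure_mono (μ := volume) hcov
  have h2 := h1.trans (measure_iUnion_fintype_le _ _)
  have hne : (Finset.univ : Finset (Fin n)).Nonempty := ⟨⟨0, by omega⟩, Finset.mem_univ _⟩
  have h3 := h2.trans_lt (ENNReal.sum_lt_sum_of_nonempty hne
    (fun i _ => bad_measure (x i) (y i) (1 / n) hr hr2))
  rw [Finset.sum_const, Finset.card_univ, Fintype.card_fin, Real.volume_Ico, nsmul_eq_mul,
    ← ENNReal.ofReal_natCast, ← ENNReal.ofReal_mul (by positivity)] at h3
  rw [mul_one_div_cancel (by positivity)] at h3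
  simp at h3


/-- Shapley–Folkman. -/
lemma shapley_folkman {n m : ℕ} (hm : 1 ≤ m) (S : Fin m → Set (Fin n → ℤ))
    (x : Fin n → ℝ) (hx : x ∈ convexHull ℝ (coeZR '' minkSumZ S)) :
    ∃ X : Fin m → Fin n → ℝ, x = ∑ i, X i ∧ (∀ i, X i ∈ convexHull ℝ (coeZR '' S i)) ∧
      ∃ B : Finset (Fin m), B.card ≤ n ∧ ∀ i ∉ B, X i ∈ coeZR '' S i := by
  classical
  have hm0 : (0:ℝ) < m := by exact_mod_cast hm
  let P : Set ((Fin n → ℝ) × (Fin m → ℝ)) :=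
    {p | ∃ i, ∃ s ∈ S i, p = (coeZR s, Pi.single i 1)}
  have hP : ((m:ℝ)⁻¹ • x, fun _ => (m:ℝ)⁻¹) ∈ convexHull ℝ P := by
    have hc : Convex ℝ {w : Fin n → ℝ |
        (((m:ℝ)⁻¹ • w, fun _ => (m:ℝ)⁻¹) : (Fin n → ℝ) × (Fin m → ℝ)) ∈ convexHull ℝ P} := by
      intro u hu v hv a b ha hb hab
      rw [Set.mem_ofPred_eq] at hu hv ⊢
      have := (convex_convexHull ℝ P) hu hv ha hb hab
      convert this using 1
      ext i
      · simp; ring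
      · simp [← add_mul, hab]
    refine convexHull_min ?_ hc hx
    rintro _ ⟨w, ⟨z, hz, rfl⟩, rfl⟩
    rw [Set.mem_ofPred_eq]
    have := (convex_convexHull ℝ P).sum_mem (t := Finset.univ) (w := fun _ : Fin m => (m:ℝ)⁻¹)
      (z := fun i => (coeZR (z i), Pi.single i 1)) (fun _ _ => by positivity)
      (by simp; field_simp) (fun i _ => subset_convexHull ℝ P ⟨i, z i, hz i, rfl⟩)
    convert this using 1
    ext i
    · simp [coeZR, Prod.fst_sum, Finset.mul_sum]
    · simp [Prod.snd_sum, Pi.single_apply]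
  obtain ⟨ι, _, z, w, hz, hai, hw, hw1, hsum⟩ := eq_pos_convex_span_of_mem_convexHull hP
  have hz' : ∀ k, ∃ i, ∃ s ∈ S i, z k = (coeZR s, Pi.single i 1) := fun k => hz ⟨k, rfl⟩
  choose c s hs hzk using hz'
  have hli : LinearIndependent ℝ z := by
    rw [Fintype.linearIndependent_iff]
    intro g hg
    have hg2 : ∑ k, g k = 0 := by
      have h2 := congrArg (fun p : (Fin n → ℝ) × (Fin m → ℝ) => ∑ i, p.2 i) hg
      simp only [Prod.snd_sum, Finset.sum_apply, hzk] at h2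
      rw [Finset.sum_comm] at h2
      simpa [Pi.single_apply] using h2
    intro k
    exact (affineIndependent_iff.1 hai) Finset.univ g hg2 hg k (Finset.mem_univ k)
  have hcard : Fintype.card ι ≤ n + m := by
    have := hli.fintype_card_le_finrank
    simpa using this
  have hfib : ∀ i, ∑ k with c k = i, w k = (m:ℝ)⁻¹ := by
    intro i
    have h2 := congrFun (congrArg Prod.snd hsum) i
    simp only [Prod.snd_sum, Finset.sum_apply, hzk] at h2
    rw [Finset.sum_filter, ← h2]
    refine Finset.sum_congr rfl fun k _ => ?_
    simp [Pi.single_apply, eq_comm]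
  have hfst : ∑ k, w k • coeZR (s k) = (m:ℝ)⁻¹ • x := by
    have h2 := congrArg Prod.fst hsum
    simpa [Prod.fst_sum, hzk] using h2
  have hfm : ∀ i, ∑ k with c k = i, (m:ℝ) * w k = 1 := by
    intro i
    rw [← Finset.mul_sum, hfib]; field_simp
  have hne : ∀ i, 1 ≤ (Finset.univ.filter fun k => c k = i).card := by
    intro i
    rw [Nat.one_le_iff_ne_zero, Ne, Finset.card_eq_zero]
    intro h0
    have := hfm i
    rw [h0] at this
    simp at this
  refine ⟨fun i => ∑ k with c k = i, ((m:ℝ) * w k) • coeZR (s k), ?_, ?_,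
    Finset.univ.filter (fun i => 2 ≤ (Finset.univ.filter fun k => c k = i).card), ?_, ?_⟩
  · rw [Finset.sum_fiberwise]
    simp_rw [mul_smul]
    rw [← Finset.smul_sum, hfst, smul_smul, mul_inv_cancel₀ hm0.ne', one_smul]
  · intro i
    refine (convex_convexHull ℝ _).sum_mem (fun k _ => ?_) (hfm i) ?_
    · have := hw k; positivity
    · intro k hk
      rw [Finset.mem_filter] at hk
      exact subset_convexHull ℝ _ ⟨s k, hk.2 ▸ hs k, rfl⟩
  · have h1 : Fintype.card ι = ∑ i, (Finset.univ.filter fun k => c k = i).card := by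
      rw [← Finset.card_univ]
      exact Finset.card_eq_sum_card_fiberwise (fun _ _ => Finset.mem_coe.2 (Finset.mem_univ _))
    have h2 : ∑ i : Fin m, (1 + if 2 ≤ (Finset.univ.filter fun k => c k = i).card then 1 else 0)
        ≤ ∑ i, (Finset.univ.filter fun k => c k = i).card := by
      refine Finset.sum_le_sum fun i _ => ?_
      have := hne i
      split_ifs <;> omega
    rw [Finset.sum_add_distrib] at h2
    rw [Finset.card_filter]
    simp only [Finset.sum_const, Finset.card_univ, Fintype.card_fin, smul_eq_mul, mul_one] at h2
    omega
  · intro i hi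
    have h1 : (Finset.univ.filter fun k => c k = i).card = 1 := by
      have := hne i
      simp only [Finset.mem_filter, Finset.mem_univ, true_and] at hi
      omega
    obtain ⟨k, hk⟩ := Finset.card_eq_one.1 h1
    have h2 := hfm i
    dsimp only
    rw [hk, Finset.sum_singleton] at h2 ⊢
    have hck : c k = i := by
      have : k ∈ Finset.univ.filter fun k => c k = i := by rw [hk]; simp
      simpa using this
    rw [h2, one_smul]
    exact ⟨s k, hck ▸ hs k, rfl⟩

lemma pair_lemma {n : ℕ} (hn : 2 ≤ n) {S T : Set (Fin n → ℤ)} (hS : MidC S) (hT : MidC T)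
    {x y : Fin n → ℝ} (hx : x ∈ convexHull ℝ (coeZR '' S)) (hy : y ∈ convexHull ℝ (coeZR '' T)) :
    ∃ s ∈ S, ∃ t ∈ T, ‖(x + y) - (coeZR s + coeZR t)‖ ≤ 1 - 1 / n := by
  obtain ⟨t, ht0, ht1, h⟩ := exists_good_t hn x y
  refine ⟨_, hS.floor_mem hx ht0 ht1, _, hT.ceil_mem hy ht0 ht1, ?_⟩
  have hn' : (2:ℝ) ≤ n := by exact_mod_cast hn
  have hr2 : (1:ℝ) / n ≤ 1 / 2 := one_div_le_one_div_of_le (by norm_num) hn'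
  rw [pi_norm_le_iff_of_nonneg (by linarith)]
  intro i
  have := h i
  rw [Real.norm_eq_abs]
  simpa [coeZR] using this

lemma sum_range_pairs {M : Type*} [AddCommMonoid M] (f : ℕ → M) (k : ℕ) :
    ∑ i ∈ Finset.range (2 * k), f i = ∑ j ∈ Finset.range k, (f (2 * j) + f (2 * j + 1)) := by
  induction k with
  | zero => simp
  | succ k ih =>
    rw [show 2 * (k + 1) = 2 * k + 1 + 1 by ring, Finset.sum_range_succ, Finset.sum_range_succ, ih,
      Finset.sum_range_succ, add_assoc]

lemma sum_extend {M : Type*} [AddCommMonoid M] {m : ℕ} (f : ℕ → M) (h0 : ∀ i, m ≤ i → f i = 0) :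
    ∑ i : Fin m, f i = ∑ j ∈ Finset.range ((m + 1) / 2), (f (2 * j) + f (2 * j + 1)) := by
  rw [← sum_range_pairs, Fin.sum_univ_eq_sum_range]
  refine Finset.sum_subset (fun i hi => ?_) fun i _ hi => ?_
  · rw [Finset.mem_range] at *; omega
  · rw [Finset.mem_range] at hi; exact h0 i (by omega)

/-- Shapley–Folkman-type theorem for L♮-convex sets: bound with m replaced by ⌈m/2⌉. -/
theorem stmt19 {n m : ℕ} (hn : 2 ≤ n) (hm : 1 ≤ m)
    (S : Fin m → Set (Fin n → ℤ)) (hS : ∀ i, LnatConvex (S i))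
    (x : Fin n → ℝ) (hx : x ∈ convexHull ℝ (coeZR '' minkSumZ S)) :
    ∃ z ∈ minkSumZ S, ‖x - coeZR z‖ ≤ (1 - 1 / n) * (min n ((m + 1) / 2) : ℕ) := by
  classical
  obtain ⟨X, hxX, hX, B, hB, hBi⟩ := shapley_folkman hm S x hx
  have hn' : (2:ℝ) ≤ n := by exact_mod_cast hn
  have hr2 : (1:ℝ) / n ≤ 1 / 2 := one_div_le_one_div_of_le (by norm_num) hn'
  -- extend to all naturals
  let S' : ℕ → Set (Fin n → ℤ) := fun i => if h : i < m then S ⟨i, h⟩ else {0}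
  let X' : ℕ → Fin n → ℝ := fun i => if h : i < m then X ⟨i, h⟩ else 0
  have hz0 : coeZR (0 : Fin n → ℤ) = 0 := by funext i; simp [coeZR]
  have hS' : ∀ i, MidC (S' i) := by
    intro i
    by_cases h : i < m
    · simp only [S', dif_pos h]; exact (hS _).midC
    · simp only [S', dif_neg h]
      rintro x rfl y rfl
      constructor <;> rfl
  have hX' : ∀ i, X' i ∈ convexHull ℝ (coeZR '' S' i) := by
    intro i
    by_cases h : i < m
    · simp only [S', X', dif_pos h]; exact hX _
    · simp only [S', X', dif_neg h]
      exact subset_convexHull ℝ _ ⟨0, rfl, hz0⟩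
  let B' : Finset ℕ := (B.image fun i : Fin m => (i : ℕ) / 2) ∩ Finset.range ((m + 1) / 2)
  have hB' : ∀ i, X' i ∉ coeZR '' S' i → i / 2 ∈ B' := by
    intro i hi
    have h : i < m := by
      by_contra h
      apply hi
      simp only [S', X', dif_neg h]
      exact ⟨0, rfl, hz0⟩
    simp only [S', X', dif_pos h] at hi
    have hb : (⟨i, h⟩ : Fin m) ∈ B := by
      by_contra hb; exact hi (hBi _ hb)
    refine Finset.mem_inter.2 ⟨Finset.mem_image.2 ⟨_, hb, rfl⟩, Finset.mem_range.2 (by omega)⟩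
  have hcard : B'.card ≤ min n ((m + 1) / 2) := by
    refine le_min ?_ ?_
    · exact (Finset.card_le_card Finset.inter_subset_left).trans (Finset.card_image_le.trans hB)
    · exact (Finset.card_le_card Finset.inter_subset_right).trans (by simp)
  have hpair : ∀ j : ℕ, ∃ s ∈ S' (2 * j), ∃ t ∈ S' (2 * j + 1),
      ‖(X' (2 * j) + X' (2 * j + 1)) - (coeZR s + coeZR t)‖ ≤
        if j ∈ B' then (1 - 1 / n : ℝ) else 0 := by
    intro j
    by_cases hj : j ∈ B'
    · simp only [if_pos hj]
      exact pair_lemma hn (hS' _) (hS' _) (hX' _) (hX' _)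
    · have h1 : X' (2 * j) ∈ coeZR '' S' (2 * j) := by
        by_contra hc
        have := hB' _ hc
        rw [show 2 * j / 2 = j by omega] at this
        exact hj this
      have h2 : X' (2 * j + 1) ∈ coeZR '' S' (2 * j + 1) := by
        by_contra hc
        have := hB' _ hc
        rw [show (2 * j + 1) / 2 = j by omega] at this
        exact hj this
      obtain ⟨s, hs, hs2⟩ := h1
      obtain ⟨t, ht, ht2⟩ := h2
      refine ⟨s, hs, t, ht, ?_⟩
      simp [hj, hs2, ht2]
  choose s hs t ht hst using hpair
  let Z : ℕ → Fin n → ℤ := fun i => if i % 2 = 0 then s (i / 2) else t (i / 2)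
  have hZe : ∀ j, Z (2 * j) = s j := by
    intro j
    simp [Z]
  have hZo : ∀ j, Z (2 * j + 1) = t j := by
    intro j
    simp only [Z]
    rw [if_neg (by omega), show (2 * j + 1) / 2 = j by omega]
  have hZ : ∀ i, Z i ∈ S' i := by
    intro i
    rcases Nat.even_or_odd' i with ⟨j, rfl | rfl⟩
    · rw [hZe]; exact hs j
    · rw [hZo]; exact ht j
  refine ⟨∑ i : Fin m, Z i, ⟨fun i => Z i, fun i => ?_, rfl⟩, ?_⟩
  · have := hZ i
    simpa [S'] using this
  have e1 : x = ∑ j ∈ Finset.range ((m + 1) / 2), (X' (2 * j) + X' (2 * j + 1)) := by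
    rw [← sum_extend X' (fun i hi => by simp [X', not_lt.2 hi]), hxX]
    refine Finset.sum_congr rfl fun i _ => ?_
    simp [X']
  have e2 : coeZR (∑ i : Fin m, Z i)
      = ∑ j ∈ Finset.range ((m + 1) / 2), (coeZR (s j) + coeZR (t j)) := by
    have h0 : ∀ i, m ≤ i → coeZR (Z i) = 0 := by
      intro i hi
      have := hZ i
      simp only [S', dif_neg (not_lt.2 hi)] at this
      rw [Set.mem_singleton_iff.1 this, hz0]
    have := sum_extend (fun i => coeZR (Z i)) h0
    simp only [hZe, hZo] at this
    rw [← this]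
    funext k
    simp [coeZR]
  rw [e1, e2, ← Finset.sum_sub_distrib]
  refine (norm_sum_le _ _).trans ((Finset.sum_le_sum fun j _ => hst j).trans ?_)
  rw [← Finset.sum_filter, Finset.sum_const, nsmul_eq_mul, mul_comm]
  refine mul_le_mul_of_nonneg_left ?_ (by linarith)
  have : (Finset.filter (fun j => j ∈ B') (Finset.range ((m + 1) / 2))).card ≤ B'.card :=
    Finset.card_le_card fun j hj => (Finset.mem_filter.1 hj).2
  exact_mod_cast this.trans hcard
end
end
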